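/- Let m∈ℤ and let ψ:ℝ→ℂ be twice differentiable. Define φ(y):=(cosh y)^{−1/2}·ψ(y). Then for every x∈ℝ: −φ″(x) − tanh(x)·φ′(x) + (m²/cosh²x)·φ(x) = (cosh x)^{−1/2}·( −ψ″(x) + V(x)·ψ(x) ), where V(x) := (8m² + 3 + cosh(2x)) / (8·cosh²x). -/

import Mathlib

/-- The derivative of `(cosh x) ^ (-1/2)` is `-(tanh x / 2) * (cosh x) ^ (-1/2)`. -/
theorem hasDerivAt_cosh_rpow_neg_half (x : ℝ) :
    HasDerivAt (fun y : ℝ => Real.cosh y ^ (-(1 / 2 : ℝ)))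
      (-(Real.tanh x / 2) * Real.cosh x ^ (-(1 / 2 : ℝ))) x := by
  have hc := Real.cosh_pos x
  convert (Real.hasDerivAt_cosh x).rpow_const (p := -(1 / 2 : ℝ)) (Or.inl hc.ne') using 1
  rw [Real.rpow_sub_one hc.ne', Real.tanh_eq_sinh_div_cosh]
  ring

/-- The derivative of `tanh` is `1 / cosh ^ 2`. -/
theorem hasDerivAt_tanh_one_div_cosh_sq (x : ℝ) :
    HasDerivAt Real.tanh (1 / Real.cosh x ^ 2) x := by
  have h := (Real.hasDerivAt_sinh x).div (Real.hasDerivAt_cosh x) (Real.cosh_pos x).ne'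
  have ht : Real.tanh = Real.sinh / Real.cosh := funext Real.tanh_eq_sinh_div_cosh
  rw [ht]
  refine h.congr_deriv ?_
  congr 1
  linear_combination Real.cosh_sq x

/-- the pointwise differential identity underlying the unitary
equivalence `U₋ψ = (cosh x)^{-1/2} ψ` between the negative-curvature transverse
Hamiltonian `H_{I(-1)}^m` and `-d²/dx² + V` with
`V(x) = (8m² + 3 + cosh 2x)/(8 cosh² x)`. -/
theorem pt_negative_curvature_transform
    (m : ℤ) (ψ ψ' ψ'' : ℝ → ℂ)
    (hd1 : ∀ x : ℝ, HasDerivAt ψ (ψ' x) x)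
    (hd2 : ∀ x : ℝ, HasDerivAt ψ' (ψ'' x) x)
    (φ : ℝ → ℂ)
    (hφ : φ = fun y : ℝ => ((Real.cosh y ^ (-(1 / 2 : ℝ)) : ℝ) : ℂ) * ψ y) :
    ∃ φ' φ'' : ℝ → ℂ,
      (∀ x : ℝ, HasDerivAt φ (φ' x) x) ∧
      (∀ x : ℝ, HasDerivAt φ' (φ'' x) x) ∧
      ∀ x : ℝ,
        -φ'' x - (Real.tanh x : ℂ) * φ' x
            + (((m : ℝ) ^ 2 / Real.cosh x ^ 2 : ℝ) : ℂ) * φ x =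
          ((Real.cosh x ^ (-(1 / 2 : ℝ)) : ℝ) : ℂ) *
            (-ψ'' x + (((8 * (m : ℝ) ^ 2 + 3 + Real.cosh (2 * x))
              / (8 * Real.cosh x ^ 2) : ℝ) : ℂ) * ψ x) := by
  subst hφ
  have hg (x : ℝ) := (hasDerivAt_cosh_rpow_neg_half x).ofReal_comp
  have ht (x : ℝ) := ((hasDerivAt_tanh_one_div_cosh_sq x).div_const 2).ofReal_comp
  refine ⟨_, fun x => ((Real.cosh x ^ (-(1 / 2 : ℝ)) : ℝ) : ℂ) *
      (ψ'' x - (Real.tanh x : ℂ) * ψ' x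
        + ((Real.tanh x ^ 2 / 4 - 1 / (2 * Real.cosh x ^ 2) : ℝ) : ℂ) * ψ x),
    fun x => (hg x).mul (hd1 x), fun x => ?_, fun x => ?_⟩
  · have h := (((ht x).neg.mul (hg x)).mul (hd1 x)).add ((hg x).mul (hd2 x))
    refine (h.congr_of_eventuallyEq (.of_forall fun y => ?_)).congr_deriv ?_
    all_goals
      simp only [Pi.add_apply, Pi.mul_apply, Pi.neg_apply]
      push_cast
      ring
  · have hV : (8 * (m : ℝ) ^ 2 + 3 + Real.cosh (2 * x)) / (8 * Real.cosh x ^ 2)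
        = (m : ℝ) ^ 2 / Real.cosh x ^ 2 + Real.tanh x ^ 2 / 4 + 1 / (2 * Real.cosh x ^ 2) := by
      have hc := (Real.cosh_pos x).ne'
      rw [Real.tanh_eq_sinh_div_cosh, Real.cosh_two_mul]
      field_simp
      linear_combination 8 * Real.cosh_sq x
    rw [hV]
    push_cast
    ring
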